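/- For all integers n ≥ 0, A_{5,2}(125n + 123) ≡ 0 (mod 125). -/

import Mathlib

/-- Hook length of the cell in row `i`, column `j` (0-indexed) of the
Ferrers–Young diagram of the partition `p` (rows sorted in decreasing order). -/
def hookLength {n : ℕ} (p : n.Partition) (i j : ℕ) : ℕ :=
  (((p.parts.sort (· ≤ ·)).reverse.getD i 0 - j) +
    ((p.parts.filter (fun x => j < x)).card - i)) - 1

/-- A partition is a `t`-core if no hook number of its Ferrers–Young diagram is
divisible by `t`. -/
def IsTCore (t : ℕ) {n : ℕ} (p : n.Partition) : Prop :=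
  ∀ i j : ℕ, j < (p.parts.sort (· ≤ ·)).reverse.getD i 0 → ¬ t ∣ hookLength p i j

/-- `numA t k n` is the number of `k`-tuples of `t`-core partitions whose sizes sum to `n`. -/
noncomputable def numA (t k n : ℕ) : ℕ :=
  Nat.card { f : Fin k → Σ m : Fin (n + 1), Nat.Partition (m : ℕ) //
    (∑ i, ((f i).1 : ℕ)) = n ∧ ∀ i, IsTCore t (f i).2 }

section

open PowerSeries

/-- The `r`-th section of a power series with respect to exponents modulo `5`. -/
noncomputable def section5 (r : ℕ) : ℤ⟦X⟧ →+ ℤ⟦X⟧ where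
  toFun F := PowerSeries.mk fun n => coeff (5 * n + r) F
  map_add' F G := by ext n; simp
  map_zero' := by ext n; simp

theorem coeff_section5 (r n : ℕ) (F : ℤ⟦X⟧) :
    coeff n (section5 r F) = coeff (5 * n + r) F := by
  simp [section5]

/-- The substitution `X ↦ X ^ 5`. -/
noncomputable abbrev expand5 : ℤ⟦X⟧ →ₐ[ℤ] ℤ⟦X⟧ := PowerSeries.expand 5 (by norm_num)

theorem section5_expand5_mul {r : ℕ} (hr : r < 5) (G F : ℤ⟦X⟧) :
    section5 r (expand5 G * F) = G * section5 r F := by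
  ext n
  rw [coeff_section5, coeff_mul, coeff_mul]
  symm
  refine Finset.sum_of_injOn (fun p => (5 * p.1, 5 * p.2 + r)) ?_ ?_ ?_ ?_
  · intro p _ q _ h
    simp only [Prod.mk.injEq] at h
    ext <;> omega
  · intro p hp
    have hp' : p.1 + p.2 = n := by simpa using hp
    have : 5 * p.1 + (5 * p.2 + r) = 5 * n + r := by omega
    simpa using this
  · intro p hp hnot
    have hp' : p.1 + p.2 = 5 * n + r := by simpa using hp
    rw [coeff_expand_of_not_dvd, zero_mul]
    rintro ⟨k, hk⟩
    refine hnot ⟨(k, n - k), ?_, ?_⟩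
    · have : k + (n - k) = n := by omega
      simpa using this
    · ext
      · exact hk.symm
      · change 5 * (n - k) + r = p.2
        omega
  · intro p _
    simp only
    rw [coeff_expand_mul, coeff_section5]

theorem section5_X_pow (r k s : ℕ) (hr : r < 5) (hs : s < 5) :
    section5 r (X ^ (5 * k + s)) = if s = r then X ^ k else 0 := by
  ext n
  rw [coeff_section5, coeff_X_pow]
  split_ifs with h1 h2 h2
  · rw [coeff_X_pow, if_pos (by omega)]
  · omega
  · rw [coeff_X_pow, if_neg (by omega)]
  · simp

theorem section5_sum {r : ℕ} (hr : r < 5) (f : ℕ → ℤ⟦X⟧) :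
    section5 r (∑ s ∈ Finset.range 5, X ^ s * expand5 (f s)) = f r := by
  rw [map_sum, Finset.sum_eq_single r]
  · rw [mul_comm, section5_expand5_mul hr]
    have := section5_X_pow r 0 r hr hr
    simp_all
  · intro s hs hsr
    have hs5 := Finset.mem_range.mp hs
    rw [mul_comm, section5_expand5_mul hr]
    have := section5_X_pow r 0 s hr hs5
    simp_all
  · intro h
    simp at h; omega

theorem expand5_injective : Function.Injective expand5 := by
  intro F G h
  ext n
  rw [← coeff_expand_mul 5 (by norm_num) F n, ← coeff_expand_mul 5 (by norm_num) G n]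
  exact congrArg (coeff (5 * n)) h

theorem eq_sum_section5 (F : ℤ⟦X⟧) :
    F = ∑ s ∈ Finset.range 5, X ^ s * expand5 (section5 s F) := by
  ext n
  have h : n = 5 * (n / 5) + n % 5 := by omega
  rw [h, ← coeff_section5, ← coeff_section5,
    section5_sum (Nat.mod_lt n (by norm_num)) (fun s => section5 s F)]

/-- Euler's product `∏ (1 - X ^ n)`, as an integral power series. -/
noncomputable abbrev eulerSeries : ℤ⟦X⟧ := pentagonalSeries ℤ

theorem coeff_eulerSeries_eq_zero {n : ℕ} (h : n % 5 = 3 ∨ n % 5 = 4) :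
    coeff n eulerSeries = 0 := by
  apply coeff_pentagonalSeries_eq_zero
  rintro ⟨k, rfl⟩
  have hk := two_mul_natCast_pentagonal k
  obtain ⟨l, hl⟩ : ∃ l, k = 5 * l + k % 5 := ⟨k / 5, by omega⟩
  have h5 : k % 5 = 0 ∨ k % 5 = 1 ∨ k % 5 = 2 ∨ k % 5 = 3 ∨ k % 5 = 4 := by omega
  have key : ∃ t : ℤ, 2 * (pentagonal k : ℤ) = 5 * t + (k % 5) * (3 * (k % 5) - 1) := by
    refine ⟨15 * l ^ 2 + 6 * l * (k % 5) - l, ?_⟩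
    rw [hk]
    conv_lhs => rw [hl]
    ring
  obtain ⟨t, ht⟩ := key
  rcases h5 with h5 | h5 | h5 | h5 | h5 <;> rw [h5] at ht <;> omega

theorem section5_one_eulerSeries : section5 1 eulerSeries = -expand5 eulerSeries := by
  ext n
  rw [coeff_section5, map_neg, coeff_expand]
  by_cases hn : ∃ k, pentagonal k = 5 * n + 1
  · obtain ⟨k, hk⟩ := hn
    have h2 := two_mul_natCast_pentagonal k
    have hk' : (pentagonal k : ℤ) = 5 * n + 1 := by rw [hk]; push_cast; ring
    obtain ⟨l, hl⟩ : ∃ l, k = 5 * l + k % 5 := ⟨k / 5, by omega⟩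
    have h5 : k % 5 = 0 ∨ k % 5 = 1 ∨ k % 5 = 2 ∨ k % 5 = 3 ∨ k % 5 = 4 := by omega
    have key : ∃ t : ℤ, 2 * (pentagonal k : ℤ) = 5 * t + (k % 5) * (3 * (k % 5) - 1) := by
      refine ⟨15 * l ^ 2 + 6 * l * (k % 5) - l, ?_⟩
      rw [h2]
      conv_lhs => rw [hl]
      ring
    obtain ⟨t, ht⟩ := key
    have h51 : k % 5 = 1 := by
      rcases h5 with h5 | h5 | h5 | h5 | h5 <;> rw [h5] at ht <;> omega
    rw [h51] at hl
    have h3 := two_mul_natCast_pentagonal (-l)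
    have hnl : n = 5 * pentagonal (-l) := by
      zify
      have : 2 * (5 * (n : ℤ) + 1) = (5 * l + 1) * (3 * (5 * l + 1) - 1) := by
        rw [← hk', h2, hl]
      linarith
    rw [← hk, if_pos (by omega), hnl, Nat.mul_div_cancel_left _ (by norm_num),
      coeff_pentagonalSeries_pentagonal, coeff_pentagonalSeries_pentagonal, hl, Int.negOnePow_add,
      Int.negOnePow_neg]
    have : (5 * l).negOnePow = l.negOnePow := by
      rw [show 5 * l = l + 2 * (2 * l) by ring, Int.negOnePow_add, Int.negOnePow_two_mul, mul_one]
    rw [this]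
    simp
  · rw [coeff_pentagonalSeries_eq_zero ℤ (by simpa using hn)]
    split_ifs with hd
    · obtain ⟨j, rfl⟩ := hd
      rw [Nat.mul_div_cancel_left _ (by norm_num), coeff_pentagonalSeries_eq_zero, neg_zero]
      rintro ⟨l, rfl⟩
      refine hn ⟨5 * (-l) + 1, ?_⟩
      have h1 := two_mul_natCast_pentagonal l
      have h2 := two_mul_natCast_pentagonal (5 * (-l) + 1)
      zify
      linarith
    · simp

/-- The quintic dissection of Euler's product. -/
theorem eulerSeries_dissection :
    eulerSeries = expand5 (section5 0 eulerSeries) - X * expand5 (expand5 eulerSeries)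
      + X ^ 2 * expand5 (section5 2 eulerSeries) := by
  have h3 : section5 3 eulerSeries = 0 := by
    ext n
    rw [coeff_section5, coeff_eulerSeries_eq_zero (by omega), map_zero]
  have h4 : section5 4 eulerSeries = 0 := by
    ext n
    rw [coeff_section5, coeff_eulerSeries_eq_zero (by omega), map_zero]
  conv_lhs => rw [eq_sum_section5 eulerSeries]
  simp only [Finset.sum_range_succ, Finset.sum_range_zero, h3, h4, section5_one_eulerSeries, map_neg,
    map_zero]
  ring

theorem constantCoeff_eulerSeries : constantCoeff eulerSeries = 1 := by
  have h : pentagonal 0 = 0 := by simp [pentagonal_def]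
  rw [← coeff_zero_eq_constantCoeff_apply, ← h, coeff_pentagonalSeries_pentagonal]
  simp

theorem eulerSeries_ne_zero : eulerSeries ≠ 0 := by
  intro h
  have := constantCoeff_eulerSeries
  rw [h] at this
  simp at this

theorem section5_zero_eulerSeries_ne_zero : section5 0 eulerSeries ≠ 0 := by
  intro h
  have h1 : coeff 0 (section5 0 eulerSeries) = 1 := by
    rw [coeff_section5]
    simpa using constantCoeff_eulerSeries
  rw [h] at h1
  simp at h1

/-- If the cube of Euler's product has no exponents congruent to `2` modulo `5`, the outer
components of its quintic dissection multiply to minus the square of the inner one. -/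
theorem section5_zero_mul_section5_two_of_cube (h : section5 2 (eulerSeries ^ 3) = 0) :
    section5 0 eulerSeries * section5 2 eulerSeries = -expand5 eulerSeries ^ 2 := by
  set A := section5 0 eulerSeries with hA
  set C := section5 2 eulerSeries with hC
  set B := expand5 eulerSeries with hB
  have hE : eulerSeries = expand5 A - X * expand5 B + X ^ 2 * expand5 C := eulerSeries_dissection
  have hcube : eulerSeries ^ 3 = ∑ s ∈ Finset.range 5, X ^ s * expand5
      ((fun s => if s = 0 then A ^ 3 - 3 * X * B * C ^ 2 else
        if s = 1 then -3 * A ^ 2 * B + X * C ^ 3 else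
        if s = 2 then 3 * A * (A * C + B ^ 2) else
        if s = 3 then - 6 * A * B * C - B ^ 3 else 3 * A * C ^ 2 + 3 * B ^ 2 * C : ℕ → ℤ⟦X⟧) s) := by
    have h3 : expand5 3 = 3 := map_ofNat _ 3
    have h6 : expand5 6 = 6 := map_ofNat _ 6
    rw [hE]
    simp [h3, h6, Finset.sum_range_succ, expand_X]
    ring
  rw [hcube, section5_sum (by norm_num)] at h
  simp only [OfNat.ofNat_ne_zero, OfNat.ofNat_ne_one, if_false, if_true] at h
  have hA0 : A ≠ 0 := section5_zero_eulerSeries_ne_zero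
  have h3 : (3 : ℤ⟦X⟧) ≠ 0 := by
    intro h0
    have h1 := congrArg (constantCoeff (R := ℤ)) h0
    rw [map_ofNat, map_zero] at h1
    norm_num at h1
  have := (mul_eq_zero.mp h).resolve_left (mul_ne_zero h3 hA0)
  linear_combination this

theorem prod_one_sub_root {ζ : ℂ} (h4 : ζ ^ 4 + ζ ^ 3 + ζ ^ 2 + ζ + 1 = 0) (Y : ℂ⟦X⟧) :
    (1 - Y) * (1 - C ζ * Y) * (1 - C ζ ^ 2 * Y) * (1 - C ζ ^ 3 * Y) * (1 - C ζ ^ 4 * Y) =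
      1 - Y ^ 5 := by
  have h : (C ζ) ^ 4 + C ζ ^ 3 + C ζ ^ 2 + C ζ + 1 = (0 : ℂ⟦X⟧) := by
    simpa using congrArg C h4
  grind

theorem prod_trinomial_root {ζ : ℂ} (h4 : ζ ^ 4 + ζ ^ 3 + ζ ^ 2 + ζ + 1 = 0) (a b c : ℂ⟦X⟧)
    (hb : a * c = -b ^ 2) :
    (a - b + c) * (a - C ζ * b + C ζ ^ 2 * c) * (a - C ζ ^ 2 * b + C ζ ^ 4 * c) *
      (a - C ζ ^ 3 * b + C ζ * c) * (a - C ζ ^ 4 * b + C ζ ^ 3 * c) =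
    a ^ 5 - 11 * b ^ 5 + c ^ 5 := by
  have h : (C ζ) ^ 4 + C ζ ^ 3 + C ζ ^ 2 + C ζ + 1 = (0 : ℂ⟦X⟧) := by
    simpa using congrArg C h4
  generalize C ζ = z at *
  grind

theorem prod_range_five_mul {M : Type*} [CommMonoid M] (f : ℕ → M) (K : ℕ) :
    ∏ i ∈ Finset.range (5 * K), f i = ∏ i ∈ Finset.range K, ∏ j ∈ Finset.range 5, f (5 * i + j) := by
  induction K with
  | zero => simp
  | succ K ih =>
    rw [Finset.prod_range_succ _ K, ← ih, mul_add, mul_one, Finset.prod_range_add]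

theorem prod_one_sub_rescale_finite {ζ : ℂ} (hζ : ζ ^ 4 + ζ ^ 3 + ζ ^ 2 + ζ + 1 = 0) (K : ℕ) :
    (∏ j ∈ Finset.range 5, ∏ i ∈ Finset.range (5 * K), (1 - (C (ζ ^ j) * X) ^ (i + 1) : ℂ⟦X⟧)) *
        ∏ i ∈ Finset.range K, (1 - X ^ (25 * (i + 1))) =
      (∏ i ∈ Finset.range (5 * K), (1 - X ^ (5 * (i + 1)))) *
        (∏ i ∈ Finset.range K, (1 - X ^ (5 * (i + 1)))) ^ 5 := by
  have h5 : ζ ^ 5 = 1 := by linear_combination (ζ - 1) * hζ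
  rw [Finset.prod_comm, prod_range_five_mul, prod_range_five_mul, ← Finset.prod_mul_distrib,
    ← Finset.prod_pow, ← Finset.prod_mul_distrib]
  refine Finset.prod_congr rfl fun i _ => ?_
  have hp (t r : ℕ) : ζ ^ (5 * t + r) = ζ ^ r := by rw [pow_add, pow_mul, h5]; simp
  have key (n : ℕ) : ∏ j ∈ Finset.range 5, (1 - (C (ζ ^ j) * X) ^ (5 * i + n) : ℂ⟦X⟧) =
      ∏ j ∈ Finset.range 5, (1 - C (ζ ^ (j * n)) * X ^ (5 * i + n)) := by
    refine Finset.prod_congr rfl fun j _ => ?_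
    rw [mul_pow, ← map_pow, ← pow_mul, show j * (5 * i + n) = 5 * (j * i) + j * n by ring, hp]
  have e (n : ℕ) (Y : ℂ⟦X⟧) (hn : n = 1 ∨ n = 2 ∨ n = 3 ∨ n = 4) :
      ∏ j ∈ Finset.range 5, (1 - C (ζ ^ (j * n)) * Y) = 1 - Y ^ 5 := by
    rw [← prod_one_sub_root hζ]
    have h6 : ζ ^ 6 = ζ ^ 1 := hp 1 1
    have h8 : ζ ^ 8 = ζ ^ 3 := hp 1 3
    have h9 : ζ ^ 9 = ζ ^ 4 := hp 1 4
    have h12 : ζ ^ 12 = ζ ^ 2 := hp 2 2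
    have h16 : ζ ^ 16 = ζ ^ 1 := hp 3 1
    rcases hn with rfl | rfl | rfl | rfl <;>
      simp only [Finset.prod_range_succ, Finset.prod_range_zero, Nat.reduceMul] <;>
      simp only [h6, h8, h9, h12, h16, pow_one] <;>
      simp only [one_mul, pow_zero, map_one, map_pow] <;> ring
  have e5 (Y : ℂ⟦X⟧) : ∏ j ∈ Finset.range 5, (1 - C (ζ ^ (j * 5)) * Y) = (1 - Y) ^ 5 := by
    simp [mul_comm _ 5, pow_mul, h5]
  have split (f : ℕ → ℂ⟦X⟧) : ∏ i ∈ Finset.range 5, f i = f 0 * f 1 * f 2 * f 3 * f 4 := by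
    simp [Finset.prod_range_succ]
  rw [split fun x => ∏ j ∈ Finset.range 5, (1 - (C (ζ ^ j) * X) ^ (5 * i + x + 1)),
    split fun x => 1 - X ^ (5 * (5 * i + x + 1))]
  simp only [add_assoc, Nat.reduceAdd, zero_add]
  rw [key 1, key 2, key 3, key 4, key 5, e 1 _ (by simp), e 2 _ (by simp), e 3 _ (by simp),
    e 4 _ (by simp), e5]
  ring

open Filter Topology WithPiTopology in
theorem tendsto_prod_one_sub_X_pow (R : Type*) [CommRing R] [TopologicalSpace R] :
    Tendsto (fun K => ∏ i ∈ Finset.range K, (1 - X ^ (i + 1) : R⟦X⟧)) atTop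
      (𝓝 (pentagonalSeries R)) :=
  (hasProd_one_sub_X_pow R).tendsto_prod_nat

open Filter Topology WithPiTopology in
theorem tendsto_prod_one_sub_X_pow_mul (R : Type*) [CommRing R] [TopologicalSpace R] (p : ℕ)
    (hp : p ≠ 0) :
    Tendsto (fun K => ∏ i ∈ Finset.range K, (1 - X ^ (p * (i + 1)) : R⟦X⟧)) atTop
      (𝓝 (expand p hp (pentagonalSeries R))) := by
  have h := tendsto_prod_one_sub_X_pow R
  rw [tendsto_iff_coeff_tendsto] at h ⊢
  intro d
  have e (K : ℕ) : ∏ i ∈ Finset.range K, (1 - X ^ (p * (i + 1)) : R⟦X⟧) =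
      expand p hp (∏ i ∈ Finset.range K, (1 - X ^ (i + 1))) := by
    simp [pow_mul]
  simp only [e, coeff_expand]
  split_ifs
  · exact h _
  · exact tendsto_const_nhds

open Filter Topology WithPiTopology in
theorem tendsto_prod_one_sub_rescale (z : ℂ) :
    Tendsto (fun K => ∏ i ∈ Finset.range K, (1 - (C z * X) ^ (i + 1) : ℂ⟦X⟧)) atTop
      (𝓝 (rescale z (pentagonalSeries ℂ))) := by
  have h := tendsto_prod_one_sub_X_pow ℂ
  rw [tendsto_iff_coeff_tendsto] at h ⊢
  intro d
  have e (K : ℕ) : ∏ i ∈ Finset.range K, (1 - (C z * X) ^ (i + 1) : ℂ⟦X⟧) =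
      rescale z (∏ i ∈ Finset.range K, (1 - X ^ (i + 1))) := by
    simp [rescale_X]
  simp only [e, coeff_rescale]
  exact (h d).const_mul _

open Filter Topology WithPiTopology in
theorem prod_rescale_pentagonalSeries {ζ : ℂ} (hζ : ζ ^ 4 + ζ ^ 3 + ζ ^ 2 + ζ + 1 = 0) :
    (∏ j ∈ Finset.range 5, rescale (ζ ^ j) (pentagonalSeries ℂ)) *
      expand 25 (by norm_num) (pentagonalSeries ℂ) =
    expand 5 (by norm_num) (pentagonalSeries ℂ) ^ 6 := by
  have h5 : Tendsto (fun K : ℕ => 5 * K) atTop atTop :=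
    tendsto_id.const_mul_atTop' (by norm_num)
  have hl := (tendsto_finsetProd (Finset.range 5)
    (fun j _ => (tendsto_prod_one_sub_rescale (ζ ^ j)).comp h5)).mul
      (tendsto_prod_one_sub_X_pow_mul ℂ 25 (by norm_num))
  have hr := ((tendsto_prod_one_sub_X_pow_mul ℂ 5 (by norm_num)).comp h5).mul
    ((tendsto_prod_one_sub_X_pow_mul ℂ 5 (by norm_num)).pow 5)
  rw [pow_succ' _ 5]
  refine tendsto_nhds_unique hl (hr.congr fun K => ?_)
  exact (prod_one_sub_rescale_finite hζ K).symm

theorem map_pentagonalSeries : map (Int.castRingHom ℂ) eulerSeries = pentagonalSeries ℂ := by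
  ext n
  rw [coeff_map]
  by_cases h : ∃ k, pentagonal k = n
  · obtain ⟨k, rfl⟩ := h
    simp
  · rw [coeff_pentagonalSeries_eq_zero _ (by simpa using h),
      coeff_pentagonalSeries_eq_zero _ (by simpa using h), map_zero]

theorem rescale_expand5 {z : ℂ} (hz : z ^ 5 = 1) (F : ℂ⟦X⟧) :
    rescale z (expand 5 (by norm_num) F) = expand 5 (by norm_num) F := by
  ext n
  rw [coeff_rescale, coeff_expand]
  split_ifs with h
  · obtain ⟨k, rfl⟩ := h
    rw [pow_mul, hz, one_pow, one_mul]
  · simp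

theorem norm_eulerSeries
    (h : section5 0 eulerSeries * section5 2 eulerSeries = -expand5 eulerSeries ^ 2) :
    (section5 0 eulerSeries ^ 5 - 11 * X * expand5 eulerSeries ^ 5
      + X ^ 2 * section5 2 eulerSeries ^ 5) * expand5 eulerSeries = eulerSeries ^ 6 := by
  obtain ⟨ζ, hζ⟩ : ∃ ζ : ℂ, IsPrimitiveRoot ζ 5 :=
    ⟨_, Complex.isPrimitiveRoot_exp 5 (by norm_num)⟩
  have h5 : ζ ^ 5 = 1 := hζ.pow_eq_one
  have h4 : ζ ^ 4 + ζ ^ 3 + ζ ^ 2 + ζ + 1 = 0 := by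
    have := hζ.geom_sum_eq_zero (by norm_num)
    simp [Finset.sum_range_succ] at this
    linear_combination this
  have hprod := prod_rescale_pentagonalSeries h4
  set A := section5 0 eulerSeries
  set B := expand5 eulerSeries with hB
  set D := section5 2 eulerSeries
  have hE : eulerSeries = expand5 A - X * expand5 B + X ^ 2 * expand5 D := eulerSeries_dissection
  apply expand5_injective
  apply PowerSeries.map_injective (Int.castRingHom ℂ) Int.cast_injective
  have h11 : expand5 11 = 11 := map_ofNat _ 11
  have e25 : expand 25 (by norm_num) (pentagonalSeries ℂ) =
      map (Int.castRingHom ℂ) (expand5 B) := by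
    rw [hB, map_expand, map_expand, map_pentagonalSeries, ← expand_mul]
  have e5 : expand 5 (by norm_num) (pentagonalSeries ℂ) =
      map (Int.castRingHom ℂ) (expand5 eulerSeries) := by
    rw [map_expand, map_pentagonalSeries]
  rw [map_pow, map_pow, ← e5, ← hprod, map_mul, map_mul, e25]
  congr 1
  set a := map (Int.castRingHom ℂ) (expand5 A) with ha
  set b := map (Int.castRingHom ℂ) (expand5 B) with hb
  set c := map (Int.castRingHom ℂ) (expand5 D) with hc
  have hEC : pentagonalSeries ℂ = a - X * b + X ^ 2 * c := by
    rw [← map_pentagonalSeries, hE]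
    simp [ha, hb, hc]
  have hac : a * (X ^ 2 * c) = -(X * b) ^ 2 := by
    have := congrArg (map (Int.castRingHom ℂ)) (congrArg expand5 h)
    simp only [map_mul, map_neg, map_pow, ← ha, ← hb, ← hc] at this
    linear_combination X ^ 2 * this
  have hres (j : ℕ) : rescale (ζ ^ j) (pentagonalSeries ℂ) =
      a - C ζ ^ j * (X * b) + C ζ ^ (2 * j) * (X ^ 2 * c) := by
    have hz : (ζ ^ j) ^ 5 = 1 := by rw [← pow_mul, mul_comm, pow_mul, h5, one_pow]
    have hra : rescale (ζ ^ j) a = a := by rw [ha, map_expand, rescale_expand5 hz]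
    have hrb : rescale (ζ ^ j) b = b := by rw [hb, map_expand, rescale_expand5 hz]
    have hrc : rescale (ζ ^ j) c = c := by rw [hc, map_expand, rescale_expand5 hz]
    rw [hEC]
    simp only [map_add, map_sub, map_mul, map_pow, rescale_X, hra, hrb, hrc]
    ring
  have hC5 : (C ζ : ℂ⟦X⟧) ^ 5 = 1 := by rw [← map_pow, h5, map_one]
  have htri := prod_trinomial_root h4 a (X * b) (X ^ 2 * c) hac
  simp only [Finset.prod_range_succ, Finset.prod_range_zero, hres, one_mul, pow_zero, mul_zero,
    Nat.reduceMul, mul_one, pow_one]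
  rw [show (C ζ : ℂ⟦X⟧) ^ 6 = C ζ by rw [pow_succ, hC5, one_mul],
    show (C ζ : ℂ⟦X⟧) ^ 8 = C ζ ^ 3 by rw [show 8 = 5 + 3 by rfl, pow_add, hC5, one_mul], htri]
  simp only [map_add, map_sub, map_mul, map_pow, expand_X, h11, map_ofNat, map_X, ← ha, ← hb, ← hc]
  ring

theorem dissection_mul_cofactor {R : Type*} [CommRing R] {a b c x : R} (h : a * c = -b ^ 2) :
    (a - x * b + x ^ 2 * c) * (a ^ 4 + x * a ^ 3 * b + 2 * x ^ 2 * a ^ 2 * b ^ 2 +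
      3 * x ^ 3 * a * b ^ 3 + 5 * x ^ 4 * b ^ 4 + 3 * x ^ 5 * c * b ^ 3 +
      2 * x ^ 6 * c ^ 2 * b ^ 2 + x ^ 7 * c ^ 3 * b + x ^ 8 * c ^ 4) =
      a ^ 5 - 11 * x ^ 5 * b ^ 5 + x ^ 10 * c ^ 5 := by
  grind

theorem sq_mul_cofactor_sq {R : Type*} [CommRing R] {a b c x : R} (h : a * c = -b ^ 2) :
    x ^ 2 * (a ^ 4 + x * a ^ 3 * b + 2 * x ^ 2 * a ^ 2 * b ^ 2 +
      3 * x ^ 3 * a * b ^ 3 + 5 * x ^ 4 * b ^ 4 + 3 * x ^ 5 * c * b ^ 3 +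
      2 * x ^ 6 * c ^ 2 * b ^ 2 + x ^ 7 * c ^ 3 * b + x ^ 8 * c ^ 4) ^ 2 =
      (10 * x ^ 5 * a ^ 5 * b ^ 3 + 15 * x ^ 10 * b ^ 8 + 10 * x ^ 15 * c ^ 5 * b ^ 3) +
      x * (5 * c ^ 6 * b ^ 2 * x ^ 15 + 20 * c * b ^ 7 * x ^ 10 + 20 * a ^ 4 * b ^ 4 * x ^ 5) +
      x ^ 2 * (2 * c ^ 7 * b * x ^ 15 + 27 * c ^ 2 * b ^ 6 * x ^ 10 + 16 * a ^ 3 * b ^ 5 * x ^ 5 +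
        a ^ 8) +
      x ^ 3 * (c ^ 8 * x ^ 15 + 16 * c ^ 3 * b ^ 5 * x ^ 10 + 27 * a ^ 2 * b ^ 6 * x ^ 5 +
        2 * a ^ 7 * b) +
      x ^ 4 * (20 * c ^ 4 * b ^ 4 * x ^ 10 + 20 * a * b ^ 7 * x ^ 5 + 5 * a ^ 6 * b ^ 2) := by
  grind

theorem mul_dissection_pow_four {R : Type*} [CommRing R] {a b c x : R} (h : a * c = -b ^ 2) :
    x * (a - x * b + x ^ 2 * c) ^ 4 = -5 * b ^ 4 * x ^ 5 +
      x * (a ^ 4 + 8 * c * b ^ 3 * x ^ 5) + x ^ 2 * (2 * c ^ 2 * b ^ 2 * x ^ 5 - 4 * a ^ 3 * b) +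
      x ^ 3 * (2 * a ^ 2 * b ^ 2 - 4 * c ^ 3 * b * x ^ 5) +
      x ^ 4 * (8 * a * b ^ 3 + c ^ 4 * x ^ 5) := by
  grind

theorem section5_zero_of_eq {F f₀ f₁ f₂ f₃ f₄ : ℤ⟦X⟧}
    (h : F = expand5 f₀ + X * expand5 f₁ + X ^ 2 * expand5 f₂ + X ^ 3 * expand5 f₃ +
      X ^ 4 * expand5 f₄) : section5 0 F = f₀ := by
  have := section5_sum (r := 0) (by norm_num) (fun s => if s = 0 then f₀ else if s = 1 then f₁ else
    if s = 2 then f₂ else if s = 3 then f₃ else f₄)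
  simpa [h, Finset.sum_range_succ] using this

theorem expand5_X : expand5 X = X ^ 5 := by simp [expand_X]

theorem section5_X_mul_eulerSeries_pow_four
    (h : section5 0 eulerSeries * section5 2 eulerSeries = -expand5 eulerSeries ^ 2) :
    section5 0 (X * eulerSeries ^ 4) = -5 * X * expand5 eulerSeries ^ 4 := by
  set A := section5 0 eulerSeries with hA
  set C := section5 2 eulerSeries with hC
  set B := expand5 eulerSeries with hB
  have hE : eulerSeries = expand5 A - X * expand5 B + X ^ 2 * expand5 C := eulerSeries_dissection
  have h' : expand5 A * expand5 C = -expand5 B ^ 2 := by rw [← map_mul, h, map_neg, map_pow]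
  apply section5_zero_of_eq (f₁ := A ^ 4 + 8 * C * B ^ 3 * X)
    (f₂ := 2 * C ^ 2 * B ^ 2 * X - 4 * A ^ 3 * B) (f₃ := 2 * A ^ 2 * B ^ 2 - 4 * C ^ 3 * B * X)
    (f₄ := 8 * A * B ^ 3 + C ^ 4 * X)
  rw [hE, mul_dissection_pow_four h']
  simp only [map_add, map_sub, map_mul, map_pow, map_neg, map_ofNat, expand5_X]
  ring

theorem section5_X_sq_mul_sq
    (h : section5 0 eulerSeries * section5 2 eulerSeries = -expand5 eulerSeries ^ 2)
    {T : ℤ⟦X⟧} (hT : eulerSeries * T = expand5 eulerSeries ^ 5) :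
    section5 0 (X ^ 2 * T ^ 2) =
      10 * X * eulerSeries ^ 4 * expand5 eulerSeries ^ 4 + 125 * (X ^ 2 * T ^ 2) := by
  have hN := norm_eulerSeries h
  set A := section5 0 eulerSeries with hA
  set C := section5 2 eulerSeries with hC
  set B := expand5 eulerSeries with hB
  have hE : eulerSeries = expand5 A - X * expand5 B + X ^ 2 * expand5 C := eulerSeries_dissection
  have h' : expand5 A * expand5 C = -expand5 B ^ 2 := by rw [← map_mul, h, map_neg, map_pow]
  have h1 := dissection_mul_cofactor (x := X) h'
  have h2 := sq_mul_cofactor_sq (x := X) h'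
  set P := expand5 A ^ 4 + X * expand5 A ^ 3 * expand5 B + 2 * X ^ 2 * expand5 A ^ 2 * expand5 B ^ 2 +
      3 * X ^ 3 * expand5 A * expand5 B ^ 3 + 5 * X ^ 4 * expand5 B ^ 4 +
      3 * X ^ 5 * expand5 C * expand5 B ^ 3 +
      2 * X ^ 6 * expand5 C ^ 2 * expand5 B ^ 2 + X ^ 7 * expand5 C ^ 3 * expand5 B +
      X ^ 8 * expand5 C ^ 4 with hP
  set N := A ^ 5 - 11 * X * B ^ 5 + X ^ 2 * C ^ 5 with hNdef
  have hEP : eulerSeries * P = expand5 N := by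
    rw [hNdef]
    simp only [map_add, map_sub, map_mul, map_pow, map_ofNat, expand5_X]
    rw [← hE] at h1
    rw [h1]
    ring
  have hXP : section5 0 (X ^ 2 * P ^ 2) = 10 * X * A ^ 5 * B ^ 3 + 15 * X ^ 2 * B ^ 8 +
      10 * X ^ 3 * C ^ 5 * B ^ 3 := by
    apply section5_zero_of_eq
      (f₁ := 5 * C ^ 6 * B ^ 2 * X ^ 3 + 20 * C * B ^ 7 * X ^ 2 + 20 * A ^ 4 * B ^ 4 * X)
      (f₂ := 2 * C ^ 7 * B * X ^ 3 + 27 * C ^ 2 * B ^ 6 * X ^ 2 + 16 * A ^ 3 * B ^ 5 * X + A ^ 8)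
      (f₃ := C ^ 8 * X ^ 3 + 16 * C ^ 3 * B ^ 5 * X ^ 2 + 27 * A ^ 2 * B ^ 6 * X + 2 * A ^ 7 * B)
      (f₄ := 20 * C ^ 4 * B ^ 4 * X ^ 2 + 20 * A * B ^ 7 * X + 5 * A ^ 6 * B ^ 2)
    rw [h2]
    simp only [map_add, map_mul, map_pow, map_ofNat, expand5_X]
    ring
  have key : N ^ 2 * section5 0 (X ^ 2 * T ^ 2) = eulerSeries ^ 10 * section5 0 (X ^ 2 * P ^ 2) := by
    rw [← section5_expand5_mul (by norm_num), ← section5_expand5_mul (by norm_num)]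
    congr 1
    rw [map_pow, map_pow, ← hEP, ← hB]
    calc (eulerSeries * P) ^ 2 * (X ^ 2 * T ^ 2) = (eulerSeries * T) ^ 2 * (X ^ 2 * P ^ 2) := by ring
      _ = _ := by rw [hT]; ring
  rw [hXP] at key
  apply mul_left_cancel₀ (pow_ne_zero 12 eulerSeries_ne_zero)
  linear_combination B ^ 2 * key - (N * B + eulerSeries ^ 6) * section5 0 (X ^ 2 * T ^ 2) * hN +
    10 * X * eulerSeries ^ 10 * B ^ 4 * hN -
      125 * X ^ 2 * eulerSeries ^ 10 * (eulerSeries * T + B ^ 5) * hT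

theorem dvd_coeff_sq
    (h : section5 0 eulerSeries * section5 2 eulerSeries = -expand5 eulerSeries ^ 2)
    {T : ℤ⟦X⟧} (hT : eulerSeries * T = expand5 eulerSeries ^ 5) (n : ℕ) :
    125 ∣ coeff (125 * n + 123) (T ^ 2) := by
  have h1 := section5_X_sq_mul_sq h hT
  have h4 := section5_X_mul_eulerSeries_pow_four h
  have h2 : section5 0 (X * eulerSeries ^ 4 * expand5 eulerSeries ^ 4) =
      -5 * (X * eulerSeries ^ 4 * expand5 eulerSeries ^ 4) := by
    rw [mul_comm, ← map_pow, section5_expand5_mul (by norm_num), h4]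
    simp only [map_pow]
    ring
  have h125 (F : ℤ⟦X⟧) : (125 : ℤ⟦X⟧) * F = (125 : ℤ) • F := by simp [zsmul_eq_mul]
  have h10 : 10 * X * eulerSeries ^ 4 * expand5 eulerSeries ^ 4 =
      (10 : ℤ) • (X * eulerSeries ^ 4 * expand5 eulerSeries ^ 4) := by
    rw [zsmul_eq_mul]; push_cast; ring
  have h5 (F : ℤ⟦X⟧) : (-5 : ℤ⟦X⟧) * F = (-5 : ℤ) • F := by simp [zsmul_eq_mul]
  rw [h10, h125] at h1
  rw [h5] at h2
  have h3 : section5 0 (section5 0 (section5 0 (X ^ 2 * T ^ 2))) = (125 : ℤ) •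
      ((2 : ℤ) • (X * eulerSeries ^ 4 * expand5 eulerSeries ^ 4) +
        section5 0 (section5 0 (X ^ 2 * T ^ 2))) := by
    rw [h1]
    simp only [map_add, map_zsmul, h1, h2, smul_add, smul_smul]
    abel
  have h6 := congrArg (coeff (n + 1)) h3
  rw [coeff_section5, coeff_section5, coeff_section5, map_zsmul,
    show 5 * (5 * (5 * (n + 1) + 0) + 0) + 0 = 125 * n + 123 + 2 by ring, coeff_X_pow_mul] at h6
  rw [h6, smul_eq_mul]
  exact dvd_mul_right _ _

/-- The Gaussian binomial coefficient with parameter `q`. -/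
def gaussBinom {R : Type*} [CommRing R] (q : R) : ℕ → ℕ → R
  | _, 0 => 1
  | 0, _ + 1 => 0
  | m + 1, k + 1 => gaussBinom q m (k + 1) + q ^ (m - k) * gaussBinom q m k

theorem gaussBinom_zero_right {R : Type*} [CommRing R] (q : R) (m : ℕ) : gaussBinom q m 0 = 1 := by
  cases m <;> rfl

theorem gaussBinom_succ_succ {R : Type*} [CommRing R] (q : R) (m k : ℕ) :
    gaussBinom q (m + 1) (k + 1) = gaussBinom q m (k + 1) + q ^ (m - k) * gaussBinom q m k := rfl

theorem gaussBinom_eq_zero {R : Type*} [CommRing R] (q : R) {m k : ℕ} (h : m < k) :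
    gaussBinom q m k = 0 := by
  induction m generalizing k with
  | zero => cases k with
    | zero => omega
    | succ k => rfl
  | succ m ih => cases k with
    | zero => omega
    | succ k => rw [gaussBinom_succ_succ, ih (by omega), ih (by omega), mul_zero, add_zero]

theorem gaussBinom_self {R : Type*} [CommRing R] (q : R) (m : ℕ) : gaussBinom q m m = 1 := by
  induction m with
  | zero => rfl
  | succ m ih => rw [gaussBinom_succ_succ, gaussBinom_eq_zero q (by omega), ih]; simp

theorem map_gaussBinom {R S : Type*} [CommRing R] [CommRing S] (f : R →+* S) (q : R) (m k : ℕ) :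
    f (gaussBinom q m k) = gaussBinom (f q) m k := by
  induction m generalizing k with
  | zero => cases k <;> simp [gaussBinom]
  | succ m ih => cases k with
    | zero => simp [gaussBinom]
    | succ k => simp [gaussBinom_succ_succ, ih]

theorem coeff_prod_add_mul_X {R : Type*} [CommRing R] (q x : R) (m k : ℕ) :
    (∏ i ∈ Finset.range m, (Polynomial.C x + Polynomial.C (q ^ i) * Polynomial.X)).coeff k =
      q ^ k.choose 2 * gaussBinom q m k * x ^ (m - k) := by
  induction m generalizing k with
  | zero =>
    cases k with
    | zero => simp [gaussBinom]
    | succ k => simp [gaussBinom, Polynomial.coeff_one]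
  | succ m ih =>
    rw [Finset.prod_range_succ, mul_add, Polynomial.coeff_add, Polynomial.coeff_mul_C, ← mul_assoc]
    cases k with
    | zero =>
      rw [ih]
      simp [gaussBinom_zero_right, pow_succ]
    | succ k =>
      rw [Polynomial.coeff_mul_X, Polynomial.coeff_mul_C, ih, ih, gaussBinom_succ_succ,
        Nat.choose_succ_succ' k 1, Nat.choose_one_right]
      rcases lt_trichotomy k m with h | h | h
      · obtain ⟨j, rfl⟩ : ∃ j, m = k + 1 + j := ⟨m - (k + 1), by omega⟩
        rw [show k + 1 + j - (k + 1) = j by omega, show k + 1 + j - k = j + 1 by omega,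
          show k + 1 + j + 1 - (k + 1) = j + 1 by omega]
        ring
      · subst h
        rw [gaussBinom_eq_zero q (by omega)]
        simp
        ring
      · rw [gaussBinom_eq_zero q (by omega : m < k + 1), gaussBinom_eq_zero q h]
        simp

theorem prod_add_mul_X {R : Type*} [CommRing R] (q x : R) (m : ℕ) :
    ∏ i ∈ Finset.range m, (Polynomial.C x + Polynomial.C (q ^ i) * Polynomial.X) =
      ∑ k ∈ Finset.range (m + 1),
        Polynomial.C (q ^ k.choose 2 * gaussBinom q m k * x ^ (m - k)) * Polynomial.X ^ k := by
  ext k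
  rw [coeff_prod_add_mul_X]
  simp only [Polynomial.finsetSum_coeff, Polynomial.coeff_C_mul_X_pow]
  by_cases h : k ≤ m
  · simp [Nat.lt_succ_iff.mpr h]
  · rw [gaussBinom_eq_zero q (by omega)]
    simp
    omega

theorem gaussBinom_mul_prod {R : Type*} [CommRing R] (q : R) (k l : ℕ) :
    gaussBinom q (k + l) k * ((∏ i ∈ Finset.range k, (1 - q ^ (i + 1))) *
      ∏ i ∈ Finset.range l, (1 - q ^ (i + 1))) = ∏ i ∈ Finset.range (k + l), (1 - q ^ (i + 1)) := by
  induction hm : k + l generalizing k l with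
  | zero =>
    obtain ⟨rfl, rfl⟩ : k = 0 ∧ l = 0 := by omega
    simp [gaussBinom]
  | succ m ih =>
    cases k with
    | zero =>
      obtain rfl : l = m + 1 := by omega
      simp [gaussBinom]
    | succ k => cases l with
      | zero =>
        obtain rfl : k = m := by omega
        simp [gaussBinom_self]
      | succ l =>
        obtain rfl : m = k + 1 + l := by omega
        have h1 := ih (k + 1) l rfl
        have h2 := ih k (l + 1) (by omega)
        rw [gaussBinom_succ_succ, show k + 1 + l - k = l + 1 by omega,
          Finset.prod_range_succ _ (k + 1 + l), show k + 1 + l + 1 = (k + 1) + (l + 1) by omega]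
        rw [Finset.prod_range_succ _ l] at h2 ⊢
        rw [Finset.prod_range_succ _ k] at h1 ⊢
        rw [pow_add q (k + 1) (l + 1)]
        linear_combination (1 - q ^ (l + 1)) * h1 + q ^ (l + 1) * (1 - q ^ (k + 1)) * h2

open Filter Topology WithPiTopology in
theorem X_pow_dvd_eulerSeries_sub_prod {m K : ℕ} (h : K ≤ m) :
    X ^ K ∣ eulerSeries - ∏ i ∈ Finset.range m, (1 - X ^ (i + 1)) := by
  have h1 (j : ℕ) : X ^ K ∣ (∏ i ∈ Finset.range (m + j), (1 - X ^ (i + 1)) : ℤ⟦X⟧) -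
      ∏ i ∈ Finset.range m, (1 - X ^ (i + 1)) := by
    induction j with
    | zero => simp
    | succ j ih =>
      rw [← add_assoc, Finset.prod_range_succ, mul_sub, mul_one, sub_right_comm]
      exact dvd_sub ih (Dvd.dvd.mul_left (pow_dvd_pow _ (by omega)) _)
  rw [X_pow_dvd_iff]
  intro d hd
  have h2 := (tendsto_iff_coeff_tendsto _ _ _ _).mp (tendsto_prod_one_sub_X_pow ℤ) d
  rw [nhds_discrete, tendsto_pure, eventually_atTop] at h2
  obtain ⟨M, hM⟩ := h2
  have h3 := X_pow_dvd_iff.mp (h1 M) d hd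
  rw [map_sub, hM _ (by omega)] at h3
  rw [map_sub, h3]

theorem isUnit_eulerSeries : IsUnit eulerSeries := by
  rw [isUnit_iff_constantCoeff, constantCoeff_eulerSeries]
  exact isUnit_one

theorem X_pow_dvd_eulerSeries_mul_gaussBinom_sub_one {k l K : ℕ} (hk : K ≤ k) (hl : K ≤ l) :
    X ^ K ∣ eulerSeries * gaussBinom X (k + l) k - 1 := by
  have h := gaussBinom_mul_prod (X : ℤ⟦X⟧) k l
  obtain ⟨u, hu⟩ := X_pow_dvd_eulerSeries_sub_prod hk
  obtain ⟨v, hv⟩ := X_pow_dvd_eulerSeries_sub_prod hl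
  obtain ⟨w, hw⟩ := X_pow_dvd_eulerSeries_sub_prod (show K ≤ k + l by omega)
  rw [sub_eq_iff_eq_add', ← sub_eq_iff_eq_add] at hu hv hw
  rw [← hu, ← hv, ← hw] at h
  rw [← isUnit_eulerSeries.dvd_mul_left]
  refine ⟨gaussBinom X (k + l) k * (eulerSeries * u + eulerSeries * v - X ^ K * u * v) - w, ?_⟩
  linear_combination h

theorem X_pow_dvd_expand5_eulerSeries_mul_gaussBinom_sub_one {k l K : ℕ} (hk : K ≤ k)
    (hl : K ≤ l) : X ^ K ∣ expand5 eulerSeries * gaussBinom (X ^ 5) (k + l) k - 1 := by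
  have h := map_dvd expand5 (X_pow_dvd_eulerSeries_mul_gaussBinom_sub_one hk hl)
  have e : expand5 (gaussBinom X (k + l) k) = gaussBinom (X ^ 5) (k + l) k := by
    rw [← expand5_X]
    exact map_gaussBinom expand5.toRingHom X (k + l) k
  rw [map_sub, map_mul, map_one, map_pow, expand5_X, e, ← pow_mul] at h
  exact (pow_dvd_pow X (by omega)).trans h

/-- Gauss's finite form of the derivative of the triple product at its trivial zero. -/
theorem sum_gaussBinom_eq {R : Type*} [CommRing R] (q : R) (n : ℕ) :
    ∑ k ∈ Finset.range (2 * n + 2), q ^ (k.choose 2 + n * (2 * n + 1 - k)) *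
      (gaussBinom q (2 * n + 1) k * (k * (-1) ^ (k - 1))) =
      q ^ (n.choose 2 + n + n ^ 2) * ((-1) ^ n *
        (∏ i ∈ Finset.range n, (1 - q ^ (i + 1))) ^ 2) := by
  have h := congrArg (fun p => (Polynomial.derivative p).eval (-1))
    (prod_add_mul_X q (q ^ n) (2 * n + 1))
  have e : ∀ k ∈ Finset.range (2 * n + 2), q ^ (k.choose 2 + n * (2 * n + 1 - k)) *
      (gaussBinom q (2 * n + 1) k * (k * (-1) ^ (k - 1))) =
      (Polynomial.derivative (Polynomial.C (q ^ k.choose 2 * gaussBinom q (2 * n + 1) k *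
        (q ^ n) ^ (2 * n + 1 - k)) * Polynomial.X ^ k)).eval (-1) := by
    intro k _
    rw [Polynomial.derivative_C_mul_X_pow, Polynomial.eval_mul, Polynomial.eval_C,
      Polynomial.eval_pow, Polynomial.eval_X]
    ring
  rw [Finset.sum_congr rfl e, ← Polynomial.eval_finsetSum, ← Polynomial.derivative_sum, ← h,
    show 2 * n + 1 = n + (1 + n) by ring, Finset.prod_range_add, Finset.prod_range_add]
  simp only [Finset.prod_range_one, Polynomial.derivative_mul, Polynomial.derivative_add,
    Polynomial.derivative_C, Polynomial.derivative_X, Polynomial.eval_add, Polynomial.eval_mul,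
    Polynomial.eval_C, Polynomial.eval_X, Polynomial.eval_prod, Polynomial.eval_zero,
    Polynomial.eval_one, add_zero]
  have hpow (b : R) : b ^ n = ∏ _i ∈ Finset.range n, b := by simp
  have e1 : ∏ i ∈ Finset.range n, (q ^ n + q ^ i * -1) =
      q ^ n.choose 2 * ((-1) ^ n * ∏ i ∈ Finset.range n, (1 - q ^ (i + 1))) := by
    rw [← Finset.prod_range_reflect (fun i => 1 - q ^ (i + 1)), Nat.choose_two_right,
      ← Finset.sum_range_id, ← Finset.prod_pow_eq_pow_sum]
    rw [hpow (-1), ← Finset.prod_mul_distrib, ← Finset.prod_mul_distrib]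
    refine Finset.prod_congr rfl fun i hi => ?_
    rw [Finset.mem_range] at hi
    obtain ⟨j, rfl⟩ : ∃ j, n = i + j + 1 := ⟨n - i - 1, by omega⟩
    rw [show i + j + 1 - 1 - i = j by omega]
    ring
  have e2 : ∏ i ∈ Finset.range n, (q ^ n + q ^ (n + (1 + i)) * -1) =
      q ^ n ^ 2 * ∏ i ∈ Finset.range n, (1 - q ^ (i + 1)) := by
    rw [sq, pow_mul]
    rw [hpow (q ^ n), ← Finset.prod_mul_distrib]
    refine Finset.prod_congr rfl fun i _ => ?_
    ring
  rw [e1, e2]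
  ring

theorem two_mul_choose_two_add (i : ℕ) : 2 * i.choose 2 + i = i ^ 2 := by
  induction i with
  | zero => rfl
  | succ i ih =>
    rw [Nat.choose_succ_succ' i 1, Nat.choose_one_right]
    linarith

theorem exists_choose_two_eq {n k : ℕ} (h : k ≤ 2 * n + 1) : ∃ i : ℕ,
    k.choose 2 + n * (2 * n + 1 - k) = n.choose 2 + n + n ^ 2 + i.choose 2 ∧
      (k = n + i ∨ k + i = n + 1) := by
  rcases le_or_gt n k with hk | hk
  · obtain ⟨i, rfl⟩ := Nat.exists_eq_add_of_le hk
    refine ⟨i, ?_, Or.inl rfl⟩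
    obtain ⟨j, hj⟩ : ∃ j, n + 1 = i + j := ⟨n + 1 - i, by omega⟩
    rw [show 2 * n + 1 - (n + i) = j by omega]
    have h1 := two_mul_choose_two_add (n + i)
    have h2 := two_mul_choose_two_add n
    have h3 := two_mul_choose_two_add i
    have h4 : n * (n + 1) = n * (i + j) := by rw [hj]
    linarith
  · obtain ⟨j, rfl⟩ := Nat.exists_eq_add_of_lt hk
    refine ⟨j + 2, ?_, Or.inr (by ring)⟩
    rw [show 2 * (k + j + 1) + 1 - k = k + j + 1 + j + 2 by omega]
    have h1 := two_mul_choose_two_add (k + j + 1)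
    have h2 := two_mul_choose_two_add k
    have h3 := two_mul_choose_two_add (j + 2)
    linarith

theorem choose_two_mod_five (i : ℕ) : i.choose 2 % 5 ≠ 2 := by
  have h (j : ℕ) : (j + 5).choose 2 = j.choose 2 + 5 * j + 10 := by
    simp [Nat.choose_succ_succ' _ 1]
    omega
  induction i using Nat.strong_induction_on with
  | _ i ih =>
    by_cases hi : i < 5
    · interval_cases i <;> decide
    · obtain ⟨j, rfl⟩ : ∃ j, i = j + 5 := ⟨i - 5, by omega⟩
      have := ih j (by omega)
      rw [h]
      omega

theorem section5_two_eulerSeries_cube : section5 2 (eulerSeries ^ 3) = 0 := by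
  ext d
  rw [coeff_section5, map_zero]
  set K := 5 * d + 3 with hK
  set n := 2 * K + 2 with hn
  set Q : ℤ⟦X⟧ := ∏ i ∈ Finset.range n, (1 - X ^ (i + 1)) with hQ
  set e := n.choose 2 + n + n ^ 2 with he
  have hQE : X ^ K ∣ eulerSeries - Q := X_pow_dvd_eulerSeries_sub_prod (by omega)
  have hcube : X ^ K ∣ eulerSeries ^ 3 - eulerSeries * Q ^ 2 := by
    obtain ⟨u, hu⟩ := hQE
    refine ⟨u * (eulerSeries * (eulerSeries + Q)), ?_⟩
    linear_combination eulerSeries * (eulerSeries + Q) * hu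
  have h1 := X_pow_dvd_iff.mp hcube (5 * d + 2) (by omega)
  rw [map_sub, sub_eq_zero] at h1
  rw [h1]
  have h2 := sum_gaussBinom_eq (X : ℤ⟦X⟧) n
  rw [← hQ, ← he] at h2
  have h3 : coeff (5 * d + 2 + e) (eulerSeries * (X ^ e * ((-1) ^ n * Q ^ 2))) = 0 := by
    rw [← h2, Finset.mul_sum, map_sum]
    apply Finset.sum_eq_zero
    intro k hk
    rw [Finset.mem_range] at hk
    obtain ⟨i, hi, hki⟩ := exists_choose_two_eq (show k ≤ 2 * n + 1 by omega)
    have hterm : eulerSeries * (X ^ (k.choose 2 + n * (2 * n + 1 - k)) *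
        (gaussBinom X (2 * n + 1) k * ((k : ℤ⟦X⟧) * (-1) ^ (k - 1)))) = X ^ e * (X ^ i.choose 2 *
          (eulerSeries * gaussBinom X (2 * n + 1) k * C ((k : ℤ) * (-1) ^ (k - 1)))) := by
      rw [hi, ← he]
      simp
      ring
    rw [hterm, coeff_X_pow_mul]
    have hi2 := two_mul_choose_two_add i
    rcases le_or_gt K (i.choose 2) with hc | hc
    · exact X_pow_dvd_iff.mp (dvd_mul_right _ _) _ (by omega)
    · have hiK : i ≤ K + 1 := by nlinarith
      obtain ⟨l, hl⟩ : ∃ l, 2 * n + 1 = k + l := ⟨2 * n + 1 - k, by omega⟩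
      rw [hl]
      obtain ⟨u, hu⟩ := X_pow_dvd_eulerSeries_mul_gaussBinom_sub_one
        (show K ≤ k by omega) (show K ≤ l by omega)
      rw [sub_eq_iff_eq_add] at hu
      rw [hu, add_mul, mul_add, map_add, one_mul, coeff_mul_C, coeff_X_pow,
        if_neg (fun h => choose_two_mod_five i (by omega)), zero_mul, add_zero, mul_assoc,
        mul_left_comm]
      exact X_pow_dvd_iff.mp (dvd_mul_right _ _) _ (by omega)
  rw [mul_left_comm, coeff_X_pow_mul, Even.neg_one_pow (by rw [hn]; exact ⟨K + 1, by ring⟩),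
    one_mul] at h3
  exact h3

theorem section5_zero_mul_section5_two :
    section5 0 eulerSeries * section5 2 eulerSeries = -expand5 eulerSeries ^ 2 :=
  section5_zero_mul_section5_two_of_cube section5_two_eulerSeries_cube

/-- The sum of the `5`-stable set of natural numbers whose elements congruent to `j` modulo `5` are
the `k j` smallest ones. -/
def stableSum (k : Fin 5 → ℕ) : ℕ := ∑ j, (5 * (k j).choose 2 + j * k j)

theorem stableSum_term_bound (m k : ℕ) (j : Fin 5) :
    5 * (m : ℤ) ^ 2 - 5 * m + 2 * j * m + (10 * m - 1) * (k - m) + ((k : ℤ) - m) ^ 2 ≤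
      2 * ((5 * k.choose 2 + j * k : ℕ) : ℤ) := by
  have hc : 2 * (k.choose 2 : ℤ) + k = k ^ 2 := mod_cast two_mul_choose_two_add k
  obtain ⟨n, hn⟩ : ∃ n : ℤ, (k : ℤ) = m + n := ⟨k - m, by ring⟩
  have h1 : n ≤ n ^ 2 := Int.le_self_sq n
  have h2 : -n ≤ n ^ 2 := by simpa using Int.le_self_sq (-n)
  push_cast
  have h3 : 2 * (k.choose 2 : ℤ) = (m + n) ^ 2 - (m + n) := by rw [← hn]; linarith
  have h4 : 2 * (5 * (k.choose 2 : ℤ) + (j : ℕ) * k) =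
      5 * ((m + n) ^ 2 - (m + n)) + 2 * (j : ℕ) * (m + n) := by rw [← h3, ← hn]; ring
  rw [h4, hn]
  fin_cases j <;> simp <;> linarith

theorem two_mul_choose_add_sq_le_stableSum {m : ℕ} {k : Fin 5 → ℕ} (h : ∑ j, k j = 5 * m)
    (j : Fin 5) : 2 * ((5 * m).choose 2 : ℤ) + ((k j : ℤ) - m) ^ 2 ≤ 2 * stableSum k := by
  have hs : (∑ j, (k j : ℤ)) = 5 * m := mod_cast h
  have hm : 2 * ((5 * m).choose 2 : ℤ) + (5 * m : ℕ) = (5 * m : ℕ) ^ 2 :=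
    mod_cast two_mul_choose_two_add (5 * m)
  have hst : (stableSum k : ℤ) = ∑ i, ((5 * (k i).choose 2 + i * k i : ℕ) : ℤ) := by
    rw [stableSum, Nat.cast_sum]
  have h1 := Finset.sum_le_sum fun i (_ : i ∈ Finset.univ) => stableSum_term_bound m (k i) i
  have h2 := Finset.single_le_sum (f := fun i => ((k i : ℤ) - m) ^ 2)
    (fun i _ => sq_nonneg _) (Finset.mem_univ j)
  rw [Finset.sum_add_distrib, Finset.sum_add_distrib, ← Finset.mul_sum, ← Finset.mul_sum,
    Finset.sum_sub_distrib, hs, ← hst] at h1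
  simp only [Fin.sum_univ_five (fun i : Fin 5 => 5 * (m : ℤ) ^ 2 - 5 * m + 2 * (i : ℕ) * m)] at h1
  simp at h1 h2 hm
  linarith

theorem pow_choose_mul_gaussBinom {R : Type*} [CommRing R] (q : R) (M N : ℕ) :
    q ^ N.choose 2 * gaussBinom q (5 * M) N =
      ∑ k ∈ (Fintype.piFinset fun _ : Fin 5 => Finset.range (M + 1)) with ∑ j, k j = N,
        q ^ stableSum k * ∏ j, gaussBinom (q ^ 5) M (k j) := by
  have h1 := coeff_prod_add_mul_X q 1 (5 * M) N
  rw [one_pow, mul_one] at h1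
  have h2 (j : Fin 5) : ∏ i ∈ Finset.range M,
      (Polynomial.C 1 + Polynomial.C (q ^ (5 * i + j)) * Polynomial.X) =
      ∑ k ∈ Finset.range (M + 1), Polynomial.C (q ^ (5 * k.choose 2 + j * k) *
        gaussBinom (q ^ 5) M k) * Polynomial.X ^ k := by
    have h3 := congrArg (fun p => p.comp (Polynomial.C (q ^ (j : ℕ)) * Polynomial.X))
      (prod_add_mul_X (q ^ 5) 1 M)
    simp only [Polynomial.prod_comp, Polynomial.add_comp, Polynomial.mul_comp, Polynomial.C_comp,
      Polynomial.X_comp, Polynomial.sum_comp, Polynomial.X_pow_comp] at h3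
    convert h3 using 1
    · refine Finset.prod_congr rfl fun i _ => ?_
      rw [← mul_assoc, ← Polynomial.C_mul]
      ring_nf
    · refine Finset.sum_congr rfl fun i _ => ?_
      rw [mul_pow, ← Polynomial.C_pow, ← mul_assoc, ← Polynomial.C_mul]
      ring_nf
  rw [← h1, prod_range_five_mul, Finset.prod_comm, Finset.prod_range, Finset.prod_congr rfl
    fun j _ => h2 j, Finset.prod_univ_sum, Polynomial.finsetSum_coeff, Finset.sum_filter]
  refine Finset.sum_congr rfl fun k _ => ?_
  rw [Finset.prod_mul_distrib, Finset.prod_pow_eq_pow_sum, ← map_prod, Polynomial.coeff_C_mul_X_pow,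
    Finset.prod_mul_distrib, Finset.prod_pow_eq_pow_sum]
  simp only [stableSum, eq_comm]

theorem eulerSeries_mul_eq_of_coeff {T : ℤ⟦X⟧} (hT : ∀ n m : ℕ, n ≤ 5 * m → coeff n T =
    ((Finset.piAntidiag Finset.univ (5 * m)).filter fun k : Fin 5 → ℕ =>
      stableSum k = (5 * m).choose 2 + n).card) :
    eulerSeries * T = expand5 eulerSeries ^ 5 := by
  suffices h : ∀ K, X ^ K ∣ eulerSeries * T - expand5 eulerSeries ^ 5 by
    rw [← sub_eq_zero]
    ext d
    exact X_pow_dvd_iff.mp (h (d + 1)) d (by omega)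
  intro K
  set m := 3 * K + 1 with hm
  set c := (5 * m).choose 2 with hc
  set B := expand5 eulerSeries with hB
  set s := (Fintype.piFinset fun _ : Fin 5 => Finset.range (2 * m + 1)).filter
    fun k => ∑ j, k j = 5 * m with hs
  have hsum := pow_choose_mul_gaussBinom (X : ℤ⟦X⟧) (2 * m) (5 * m)
  rw [← hc, ← hs] at hsum
  have hbound (k : Fin 5 → ℕ) (hk : ∑ j, k j = 5 * m) : c ≤ stableSum k := by
    have := two_mul_choose_add_sq_le_stableSum hk 0
    have := sq_nonneg ((k 0 : ℤ) - m)
    zify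
    linarith
  have hfar (k : Fin 5 → ℕ) (hk : ∑ j, k j = 5 * m) (j : Fin 5)
      (hj : k j < K ∨ 2 * m < k j + K) : c + K ≤ stableSum k := by
    have h1 := two_mul_choose_add_sq_le_stableSum hk j
    have h2 : (2 * K + 1 : ℤ) ^ 2 ≤ ((k j : ℤ) - m) ^ 2 := by
      have hm' : (m : ℤ) = 3 * K + 1 := mod_cast hm
      rcases hj with hj | hj
      · have : (k j : ℤ) < K := mod_cast hj
        nlinarith
      · have : (2 * m : ℤ) < k j + K := mod_cast hj
        nlinarith
    zify
    nlinarith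
  have hT' : X ^ (c + K) ∣ ∑ k ∈ s, X ^ stableSum k - X ^ c * T := by
    rw [X_pow_dvd_iff]
    intro d hd
    rw [map_sub, map_sum, coeff_X_pow_mul', sub_eq_zero]
    simp only [coeff_X_pow, Finset.sum_boole]
    split_ifs with hcd
    · obtain ⟨n, rfl⟩ := Nat.exists_eq_add_of_le hcd
      rw [Nat.add_sub_cancel_left, hT n m (by omega)]
      congr 2
      ext k
      simp only [hs, Finset.mem_filter, Fintype.mem_piFinset, Finset.mem_range,
        Finset.mem_piAntidiag, Finset.mem_univ, implies_true, and_true, eq_comm (a := c + n)]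
      constructor
      · rintro ⟨⟨-, h1⟩, h2⟩
        exact ⟨h1, h2⟩
      · rintro ⟨h1, h2⟩
        refine ⟨⟨fun j => ?_, h1⟩, h2⟩
        by_contra hj
        have := hfar k h1 j (by omega)
        omega
    · rw [Nat.cast_eq_zero, Finset.card_eq_zero, Finset.filter_eq_empty_iff]
      rintro k hk rfl
      exact hcd (hbound k (Finset.mem_filter.mp hk).2)
  have hprod : X ^ (c + K) ∣ ∑ k ∈ s, X ^ stableSum k * (B ^ 5 * ∏ j, gaussBinom (X ^ 5) (2 * m) (k j))
      - ∑ k ∈ s, X ^ stableSum k := by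
    rw [← Finset.sum_sub_distrib]
    refine Finset.dvd_sum fun k hk => ?_
    have hk5 := (Finset.mem_filter.mp hk).2
    by_cases hj : ∃ j, k j < K ∨ 2 * m < k j + K
    · obtain ⟨j, hj⟩ := hj
      have := pow_dvd_pow (X : ℤ⟦X⟧) (hfar k hk5 j hj)
      exact dvd_sub (this.mul_right _) this
    · push Not at hj
      have h1 : X ^ K ∣ ∏ j, (B * gaussBinom (X ^ 5) (2 * m) (k j)) - 1 := by
        refine Finset.prod_induction _ (fun x => X ^ K ∣ x - 1) (fun a b ha hb => ?_) (by simp)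
          fun j _ => ?_
        · have := dvd_add (ha.mul_right b) hb
          convert this using 1
          ring
        · obtain ⟨l, hl⟩ : ∃ l, 2 * m = k j + l := ⟨2 * m - k j, by have := hj j; omega⟩
          rw [hl]
          exact X_pow_dvd_expand5_eulerSeries_mul_gaussBinom_sub_one (hj j).1
            (by have := hj j; omega)
      rw [Finset.prod_mul_distrib, Finset.prod_const, Finset.card_univ, Fintype.card_fin] at h1
      have h2 := mul_dvd_mul (pow_dvd_pow (X : ℤ⟦X⟧) (hbound k hk5)) h1
      rwa [← pow_add, mul_sub, mul_one] at h2
  have hleft := X_pow_dvd_eulerSeries_mul_gaussBinom_sub_one (show K ≤ 5 * m by omega)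
    (show K ≤ 5 * m by omega)
  rw [show 5 * m + 5 * m = 5 * (2 * m) by ring] at hleft
  obtain ⟨u, hu⟩ := hT'
  obtain ⟨v, hv⟩ := hprod
  obtain ⟨w, hw⟩ := hleft
  have hX : (X : ℤ⟦X⟧) ^ c ≠ 0 := pow_ne_zero _ X_ne_zero
  refine ⟨w * B ^ 5 - eulerSeries * (u + v), mul_left_cancel₀ hX ?_⟩
  have h5 : ∑ k ∈ s, X ^ stableSum k * (B ^ 5 * ∏ j, gaussBinom (X ^ 5) (2 * m) (k j)) =
      B ^ 5 * (X ^ c * gaussBinom X (5 * (2 * m)) (5 * m)) := by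
    rw [hsum, Finset.mul_sum]
    exact Finset.sum_congr rfl fun k _ => by ring
  rw [h5] at hv
  linear_combination (-eulerSeries) * (hu + hv) + X ^ c * B ^ 5 * hw

end

/-- Hook lengths are read off from the beta-numbers `l i + (N - 1 - i)`: none of them is divisible
by `t` exactly when the set of beta-numbers is stable under subtraction of `t`. -/
theorem forall_not_dvd_hook_iff {t : ℕ} (ht : 0 < t) {l c : ℕ → ℕ} {N : ℕ}
    (hlc : ∀ i j, j < l i ↔ i < c j) (hN : l N = 0) :
    (∀ i j, j < l i → ¬ t ∣ (l i - j + (c j - i)) - 1) ↔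
      ∀ i < N, t ≤ l i + (N - 1 - i) → ∃ i' < N, l i' + (N - 1 - i') + t = l i + (N - 1 - i) := by
  have hanti : Antitone l := by
    intro a b hab
    by_contra h
    have h1 := (hlc b (l a)).mp (by omega)
    have h2 := (hlc a (l a)).mpr (by omega)
    omega
  have hcN (j : ℕ) : c j ≤ N := by
    by_contra h
    have := (hlc N j).mpr (by omega)
    omega
  constructor
  · intro h i hi hti
    by_contra hno
    push Not at hno
    obtain ⟨y, hy⟩ := Nat.exists_eq_add_of_le' hti
    have hex : ∃ r, r = N ∨ l r + (N - 1 - r) ≤ y := ⟨N, Or.inl rfl⟩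
    set r := Nat.find hex with hr
    have hspec := Nat.find_spec hex
    rw [← hr] at hspec
    have hmin : ∀ r' < r, r' ≠ N ∧ y < l r' + (N - 1 - r') := by
      intro r' hr'
      have := Nat.find_min hex hr'
      push Not at this
      exact this
    have hrN : r ≤ N := Nat.find_min' hex (Or.inl rfl)
    have hir : i < r := by
      by_contra hc
      have := hanti (not_lt.mp hc)
      omega
    have hpred := hmin (r - 1) (by omega)
    have hlr : l r + N ≤ y + r := by
      rcases hspec with hs | hs
      · rw [hs, hN]
        omega
      · rcases hrN.lt_or_eq with hlt | heq
        · have := hno r hlt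
          omega
        · rw [heq, hN]
          omega
    set j := y + r - N with hj
    have h1 : r - 1 < c j := (hlc _ _).mp (by omega)
    have h2 : ¬ r < c j := fun hc => by
      have := (hlc r j).mpr hc
      omega
    have h3 : l (r - 1) ≤ l i := hanti (by omega)
    refine h i j (by omega) ?_
    rw [show l i - j + (c j - i) - 1 = t by omega]
  · rintro h i j hij ⟨d, hd⟩
    have hic := (hlc i j).mp hij
    have hcj := hcN j
    have hdesc : ∀ d y, l i + (N - 1 - i) = y + t * d → ∃ i' < N, l i' + (N - 1 - i') = y := by
      intro d
      induction d with
      | zero => exact fun y hy => ⟨i, by omega, by omega⟩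
      | succ d ih =>
        intro y hy
        obtain ⟨i', hi', he⟩ := ih (y + t) (by rw [hy]; ring)
        obtain ⟨i'', hi'', he'⟩ := h i' hi' (by omega)
        exact ⟨i'', hi'', by omega⟩
    obtain ⟨i', hi', he⟩ := hdesc d (N + j - c j) (by omega)
    by_cases hc : i' < c j
    · have := (hlc i' j).mpr hc
      omega
    · have := (hlc i' j).not.mpr hc
      omega

theorem lt_getD_iff_lt_length_filter {L : List ℕ} (hL : L.Pairwise (· ≥ ·)) (i j : ℕ) :
    j < L.getD i 0 ↔ i < (L.filter (fun x => j < x)).length := by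
  induction L generalizing i with
  | nil => simp
  | cons a L ih =>
    rw [List.pairwise_cons] at hL
    by_cases ha : j < a
    · cases i with
      | zero => simp [ha]
      | succ i => simpa [ha] using ih hL.2 i
    · have h0 : ∀ x ∈ L, ¬ j < x := fun x hx => by have := hL.1 x hx; omega
      have h1 : (a :: L).filter (fun x => j < x) = [] := by
        simp only [List.filter_eq_nil_iff, List.mem_cons, decide_eq_true_eq]
        rintro x (rfl | hx)
        · exact ha
        · exact h0 x hx
      rw [h1]
      simp only [List.length_nil, not_lt_zero, iff_false]
      cases i with
      | zero => simpa using ha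
      | succ i =>
        rw [List.getD_cons_succ, ih hL.2, List.filter_eq_nil_iff.mpr (by simpa using h0)]
        simp

theorem sum_range_getD {L : List ℕ} {N : ℕ} (h : L.length ≤ N) :
    ∑ i ∈ Finset.range N, L.getD i 0 = L.sum := by
  induction L generalizing N with
  | nil => simp
  | cons a L ih =>
    obtain ⟨N, rfl⟩ : ∃ M, N = M + 1 := ⟨N - 1, by simp at h; omega⟩
    rw [Finset.sum_range_succ']
    simp only [List.getD_cons_succ, List.getD_cons_zero, List.sum_cons]
    rw [ih (by simpa using h), add_comm]

/-- The `i`-th largest part of a partition, or `0`. -/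
def rowLength {n : ℕ} (p : n.Partition) (i : ℕ) : ℕ := (p.parts.sort (· ≤ ·)).reverse.getD i 0

theorem lt_rowLength_iff {n : ℕ} (p : n.Partition) (i j : ℕ) :
    j < rowLength p i ↔ i < (p.parts.filter (fun x => j < x)).card := by
  rw [rowLength, lt_getD_iff_lt_length_filter]
  · conv_rhs => rw [← Multiset.sort_eq p.parts (· ≤ ·)]
    rw [Multiset.filter_coe, Multiset.coe_card, List.filter_reverse, List.length_reverse]
  · rw [List.pairwise_reverse]
    exact Multiset.pairwise_sort _ _

theorem card_parts_le {n : ℕ} (p : n.Partition) : p.parts.card ≤ n := by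
  have := Multiset.card_nsmul_le_sum (s := p.parts) (a := 1) fun x hx => p.parts_pos hx
  rwa [p.parts_sum, smul_eq_mul, mul_one] at this

theorem rowLength_eq_zero {n N : ℕ} (p : n.Partition) (h : n ≤ N) : rowLength p N = 0 := by
  rw [rowLength, List.getD_eq_default]
  simpa using (card_parts_le p).trans h

theorem sum_rowLength {n N : ℕ} (p : n.Partition) (h : n ≤ N) :
    ∑ i ∈ Finset.range N, rowLength p i = n := by
  simp only [rowLength]
  rw [sum_range_getD (by simpa using (card_parts_le p).trans h), List.sum_reverse]
  conv_rhs => rw [← p.parts_sum, ← Multiset.sort_eq p.parts (· ≤ ·)]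
  rw [Multiset.sum_coe]

theorem antitone_rowLength {n : ℕ} (p : n.Partition) : Antitone (rowLength p) := by
  intro a b hab
  by_contra h
  have h1 := (lt_rowLength_iff p b (rowLength p a)).mp (by omega)
  have h2 := (lt_rowLength_iff p a (rowLength p a)).mpr (by omega)
  omega

theorem rowLength_injective {n : ℕ} : Function.Injective (rowLength (n := n)) := by
  intro p q h
  have hlen (p : n.Partition) (i : ℕ) : 0 < rowLength p i ↔ i < p.parts.card := by
    rw [lt_rowLength_iff, Multiset.filter_eq_self.mpr fun x hx => p.parts_pos hx]
  have hcard : p.parts.card = q.parts.card := by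
    have h1 := hlen p
    rw [h] at h1
    have h2 (i : ℕ) : i < p.parts.card ↔ i < q.parts.card := (h1 i).symm.trans (hlen q i)
    have h3 := h2 p.parts.card
    have h4 := h2 q.parts.card
    omega
  have hlist : (p.parts.sort (· ≤ ·)).reverse = (q.parts.sort (· ≤ ·)).reverse := by
    refine List.ext_getElem (by simpa using hcard) fun i h1 h2 => ?_
    have := congrFun h i
    rwa [rowLength, rowLength, List.getD_eq_getElem _ _ h1, List.getD_eq_getElem _ _ h2] at this
  apply Nat.Partition.ext
  rw [← Multiset.sort_eq p.parts (· ≤ ·), ← Multiset.sort_eq q.parts (· ≤ ·),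
    List.reverse_injective hlist]

theorem exists_rowLength_eq {n N : ℕ} {l : ℕ → ℕ} (hl : Antitone l) (hN : l N = 0)
    (hsum : ∑ i ∈ Finset.range N, l i = n) : ∃ p : n.Partition, rowLength p = l := by
  have hsum' : ((Multiset.range N).map l).sum = n := hsum
  refine ⟨Nat.Partition.ofSums n ((Multiset.range N).map l) hsum', ?_⟩
  funext i
  refine eq_of_forall_lt_iff fun j => ?_
  rw [lt_rowLength_iff]
  have hex : ∃ r, l r ≤ j := ⟨N, by omega⟩
  have hr (i : ℕ) : j < l i ↔ i < Nat.find hex := by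
    rw [Nat.lt_find_iff]
    constructor
    · intro h m hm
      have := hl hm
      omega
    · intro h
      have := h i le_rfl
      omega
  have hrN : Nat.find hex ≤ N := Nat.find_min' hex (by omega)
  rw [hr]
  have hcard : (((Nat.Partition.ofSums n ((Multiset.range N).map l) hsum').parts).filter
      (fun x => j < x)).card = Nat.find hex := by
    rw [Nat.Partition.ofSums, Multiset.filter_filter, Multiset.filter_map, Multiset.card_map]
    have : ((Finset.range N).filter (fun i => j < l i)) = Finset.range (Nat.find hex) := by
      ext i
      simp only [Finset.mem_filter, Finset.mem_range, hr]
      omega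
    rw [← Finset.card_range (Nat.find hex), ← this, Finset.card_def, Finset.filter_val,
      Finset.range_val]
    congr 1
    refine Multiset.filter_congr fun i _ => ?_
    simp only [Function.comp_apply]
    omega
  rw [hcard]

/-- The beta-numbers of a partition, in increasing order. -/
def betaNumber {n : ℕ} (N : ℕ) (p : n.Partition) (i : Fin N) : ℕ := rowLength p (N - 1 - i) + i

theorem strictMono_betaNumber {n N : ℕ} (p : n.Partition) : StrictMono (betaNumber N p) := by
  intro a b hab
  have := antitone_rowLength p (show N - 1 - b ≤ N - 1 - a by omega)
  simp only [betaNumber]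
  have : (a : ℕ) < b := hab
  omega

/-- The set of beta-numbers of a partition. -/
def betaSet {n : ℕ} (N : ℕ) (p : n.Partition) : Finset ℕ := Finset.univ.image (betaNumber N p)

theorem card_betaSet {n N : ℕ} (p : n.Partition) : (betaSet N p).card = N := by
  rw [betaSet, Finset.card_image_of_injective _ (strictMono_betaNumber p).injective]
  simp

theorem mem_betaSet {n N : ℕ} {p : n.Partition} {s : ℕ} :
    s ∈ betaSet N p ↔ ∃ i < N, rowLength p i + (N - 1 - i) = s := by
  simp only [betaSet, Finset.mem_image, Finset.mem_univ, true_and, betaNumber]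
  constructor
  · rintro ⟨i, rfl⟩
    refine ⟨N - 1 - i, by omega, ?_⟩
    rw [show N - 1 - (N - 1 - (i : ℕ)) = i by omega]
  · rintro ⟨i, hi, rfl⟩
    refine ⟨⟨N - 1 - i, by omega⟩, ?_⟩
    simp only
    rw [show N - 1 - (N - 1 - i) = i by omega]

theorem sum_betaSet {n N : ℕ} (p : n.Partition) (h : n ≤ N) :
    ∑ s ∈ betaSet N p, s = N.choose 2 + n := by
  rw [betaSet, Finset.sum_image (strictMono_betaNumber p).injective.injOn]
  simp only [betaNumber]
  rw [Finset.sum_add_distrib, ← Finset.sum_range (fun i => rowLength p (N - 1 - i)),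
    ← Finset.sum_range (fun i => i), Finset.sum_range_reflect, sum_rowLength p h,
    Finset.sum_range_id, Nat.choose_two_right, add_comm]

theorem betaSet_injective {n N : ℕ} (h : n ≤ N) :
    Function.Injective (betaSet (n := n) N) := by
  intro p q hpq
  have hmem (p : n.Partition) (i : Fin N) : betaNumber N p i ∈ betaSet N p :=
    Finset.mem_image_of_mem _ (Finset.mem_univ i)
  have h1 := Finset.orderEmbOfFin_unique (card_betaSet p) (hmem p) (strictMono_betaNumber p)
  have h2 := Finset.orderEmbOfFin_unique (card_betaSet p) (fun i => hpq ▸ hmem q i)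
    (strictMono_betaNumber q)
  have h3 : betaNumber N p = betaNumber N q := h1.trans h2.symm
  apply rowLength_injective
  funext i
  rcases lt_or_ge i N with hi | hi
  · have := congrFun h3 ⟨N - 1 - i, by omega⟩
    simp only [betaNumber] at this
    rw [show N - 1 - (N - 1 - i) = i by omega] at this
    omega
  · rw [rowLength_eq_zero p (by omega), rowLength_eq_zero q (by omega)]

theorem exists_betaSet_eq {n N : ℕ} {S : Finset ℕ} (hcard : S.card = N)
    (hsum : ∑ s ∈ S, s = N.choose 2 + n) : ∃ p : n.Partition, betaSet N p = S := by
  set e := S.orderEmbOfFin hcard with he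
  have hstep : ∀ d a : ℕ, ∀ h : a + d < N, e ⟨a, by omega⟩ + d ≤ e ⟨a + d, h⟩ := by
    intro d
    induction d with
    | zero => simp
    | succ d ih =>
      intro a h
      have h1 := ih a (by omega)
      have h2 : e ⟨a + d, by omega⟩ < e ⟨a + (d + 1), h⟩ :=
        e.strictMono (by simp [Fin.lt_def])
      omega
  have hge : ∀ i (hi : i < N), i ≤ e ⟨i, hi⟩ := by
    intro i hi
    have := hstep i 0 (by omega)
    simp only [zero_add] at this
    omega
  set l : ℕ → ℕ := fun i => if h : i < N then e ⟨N - 1 - i, by omega⟩ - (N - 1 - i) else 0 with hl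
  have hlanti : Antitone l := by
    intro a b hab
    simp only [hl]
    split_ifs with hb ha
    · have h1 := hstep (b - a) (N - 1 - b) (by omega)
      simp only [show N - 1 - b + (b - a) = N - 1 - a by omega] at h1
      omega
    · omega
    · omega
    · omega
  have hbeta (i : Fin N) : l (N - 1 - i) + i = e i := by
    have hi := i.isLt
    simp only [hl, dif_pos (show N - 1 - (i : ℕ) < N by omega),
      show N - 1 - (N - 1 - (i : ℕ)) = i by omega, Fin.eta]
    have := hge i hi
    simp only [Fin.eta] at this
    omega
  have himage : Finset.univ.image (fun i => e i) = S := by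
    rw [he]
    exact Finset.image_orderEmbOfFin_univ S hcard
  have hsum' : ∑ i ∈ Finset.range N, l i = n := by
    rw [← himage, Finset.sum_image e.injective.injOn] at hsum
    simp only [← hbeta] at hsum
    rw [Finset.sum_add_distrib, ← Finset.sum_range (fun i => l (N - 1 - i)),
      ← Finset.sum_range (fun i => i), Finset.sum_range_reflect,
      Finset.sum_range_id, ← Nat.choose_two_right] at hsum
    omega
  obtain ⟨p, hp⟩ := exists_rowLength_eq hlanti (by simp [hl] : l N = 0) hsum'
  refine ⟨p, ?_⟩
  rw [betaSet, ← himage]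
  congr 1
  funext i
  rw [betaNumber, hp, hbeta]

theorem isTCore_iff {t n N : ℕ} (ht : 0 < t) (p : n.Partition) (h : n ≤ N) :
    IsTCore t p ↔ ∀ s ∈ betaSet N p, t ≤ s → s - t ∈ betaSet N p := by
  have h1 := forall_not_dvd_hook_iff ht (lt_rowLength_iff p) (rowLength_eq_zero p h)
  refine Iff.trans h1 ?_
  simp only [mem_betaSet]
  constructor
  · rintro h2 s ⟨i, hi, rfl⟩ hs
    obtain ⟨i', hi', he⟩ := h2 i hi hs
    exact ⟨i', hi', by omega⟩
  · intro h2 i hi hs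
    obtain ⟨i', hi', he⟩ := h2 _ ⟨i, hi, rfl⟩ hs
    exact ⟨i', hi', by omega⟩

/-- The set whose elements congruent to `j` modulo `5` are the `k j` smallest ones. -/
def stableSet (k : Fin 5 → ℕ) : Finset ℕ :=
  (Finset.univ.sigma fun j => Finset.range (k j)).image fun x => 5 * x.2 + (x.1 : ℕ)

theorem injective_five_mul_add :
    Function.Injective fun x : (_ : Fin 5) × ℕ => 5 * x.2 + (x.1 : ℕ) := by
  rintro ⟨a, b⟩ ⟨c, d⟩ h
  simp only at h
  have h1 : a = c := by
    ext
    omega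
  subst h1
  have h2 : b = d := by omega
  rw [h2]

theorem five_mul_add_mem_stableSet {k : Fin 5 → ℕ} {j : Fin 5} {t : ℕ} :
    5 * t + (j : ℕ) ∈ stableSet k ↔ t < k j := by
  simp only [stableSet]
  rw [injective_five_mul_add.mem_finset_image (a := ⟨j, t⟩)]
  simp

theorem stableSet_injective : Function.Injective stableSet := by
  intro k k' h
  funext j
  refine eq_of_forall_lt_iff fun t => ?_
  rw [← five_mul_add_mem_stableSet, h, five_mul_add_mem_stableSet]

theorem card_stableSet (k : Fin 5 → ℕ) : (stableSet k).card = ∑ j, k j := by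
  rw [stableSet, Finset.card_image_of_injective _ injective_five_mul_add]
  simp

theorem sum_stableSet (k : Fin 5 → ℕ) : ∑ s ∈ stableSet k, s = stableSum k := by
  rw [stableSet, Finset.sum_image injective_five_mul_add.injOn, Finset.sum_sigma, stableSum]
  refine Finset.sum_congr rfl fun j _ => ?_
  rw [Finset.sum_add_distrib, ← Finset.mul_sum, Finset.sum_range_id, Nat.choose_two_right]
  simp [mul_comm]

theorem sub_five_mem_stableSet {k : Fin 5 → ℕ} {s : ℕ} (hs : s ∈ stableSet k) (h5 : 5 ≤ s) :
    s - 5 ∈ stableSet k := by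
  obtain ⟨t, j, rfl⟩ : ∃ t, ∃ j : Fin 5, s = 5 * t + j :=
    ⟨s / 5, ⟨s % 5, Nat.mod_lt _ (by norm_num)⟩, by simp; omega⟩
  rw [five_mul_add_mem_stableSet] at hs
  have : 0 < t := by omega
  rw [show 5 * t + (j : ℕ) - 5 = 5 * (t - 1) + j by omega, five_mul_add_mem_stableSet]
  omega

theorem exists_stableSet_eq {S : Finset ℕ} (h : ∀ s ∈ S, 5 ≤ s → s - 5 ∈ S) :
    ∃ k, stableSet k = S := by
  have hex (j : Fin 5) : ∃ t, 5 * t + (j : ℕ) ∉ S :=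
    ⟨S.sup id + 1, fun hmem => by
      have := Finset.le_sup (f := id) hmem
      simp only [id] at this
      omega⟩
  have hdown : ∀ d t j, 5 * (t + d) + j ∈ S → 5 * t + j ∈ S := by
    intro d
    induction d with
    | zero => exact fun t j ht => ht
    | succ d ih =>
      intro t j ht
      have := h _ ht (by omega)
      rw [show 5 * (t + (d + 1)) + j - 5 = 5 * (t + d) + j by omega] at this
      exact ih t j this
  refine ⟨fun j => Nat.find (hex j), ?_⟩
  ext s
  obtain ⟨t, j, rfl⟩ : ∃ t, ∃ j : Fin 5, s = 5 * t + j :=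
    ⟨s / 5, ⟨s % 5, Nat.mod_lt _ (by norm_num)⟩, by simp; omega⟩
  rw [five_mul_add_mem_stableSet, Nat.lt_find_iff]
  constructor
  · intro ht
    have := ht t le_rfl
    rwa [not_not] at this
  · intro ht m hm
    rw [not_not]
    obtain ⟨d, rfl⟩ := Nat.exists_eq_add_of_le hm
    exact hdown d m j ht

theorem card_isTCore_five {n m : ℕ} (h : n ≤ 5 * m) :
    Nat.card {p : n.Partition // IsTCore 5 p} =
      ((Finset.piAntidiag Finset.univ (5 * m)).filter fun k : Fin 5 → ℕ =>
        stableSum k = (5 * m).choose 2 + n).card := by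
  classical
  rw [Nat.card_eq_fintype_card, Fintype.card_subtype,
    ← Finset.card_image_of_injective _ (betaSet_injective h),
    ← Finset.card_image_of_injective _ stableSet_injective]
  congr 1
  ext S
  simp only [Finset.mem_image, Finset.mem_filter, Finset.mem_univ, true_and,
    Finset.mem_piAntidiag, implies_true, and_true]
  constructor
  · rintro ⟨p, hp, rfl⟩
    obtain ⟨k, hk⟩ := exists_stableSet_eq ((isTCore_iff (by norm_num) p h).mp hp)
    refine ⟨k, ⟨?_, ?_⟩, hk⟩
    · rw [← card_stableSet, hk, card_betaSet]
    · rw [← sum_stableSet, hk, sum_betaSet p h]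
  · rintro ⟨k, ⟨hk1, hk2⟩, rfl⟩
    obtain ⟨p, hp⟩ := exists_betaSet_eq ((card_stableSet k).trans hk1)
      ((sum_stableSet k).trans hk2)
    refine ⟨p, ?_, hp⟩
    rw [isTCore_iff (by norm_num) p h, hp]
    exact fun s hs h5 => sub_five_mem_stableSet hs h5

/-- Pairs of `t`-cores of total size `n`, sorted by the sizes of the two components. -/
def pairEquiv (t n : ℕ) : { f : Fin 2 → Σ m : Fin (n + 1), Nat.Partition (m : ℕ) //
    (∑ i, ((f i).1 : ℕ)) = n ∧ ∀ i, IsTCore t (f i).2 } ≃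
    Σ x : Finset.HasAntidiagonal.antidiagonal n,
      {p : x.1.1.Partition // IsTCore t p} × {p : x.1.2.Partition // IsTCore t p} where
  toFun f := ⟨⟨((f.1 0).1, (f.1 1).1), by
    have := f.2.1
    rw [Fin.sum_univ_two] at this
    simpa using this⟩, ⟨(f.1 0).2, f.2.2 0⟩, ⟨(f.1 1).2, f.2.2 1⟩⟩
  invFun x := ⟨![⟨⟨x.1.1.1, Nat.lt_succ_of_le (Finset.HasAntidiagonal.antidiagonal.fst_le x.1.2)⟩, x.2.1.1⟩,
    ⟨⟨x.1.1.2, Nat.lt_succ_of_le (Finset.HasAntidiagonal.antidiagonal.snd_le x.1.2)⟩, x.2.2.1⟩], by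
      simpa using Finset.HasAntidiagonal.mem_antidiagonal.mp x.1.2, by
      intro i
      fin_cases i
      · exact x.2.1.2
      · exact x.2.2.2⟩
  left_inv f := by
    apply Subtype.ext
    funext i
    fin_cases i <;> rfl
  right_inv x := rfl

theorem numA_two (t n : ℕ) : numA t 2 n = ∑ x ∈ Finset.HasAntidiagonal.antidiagonal n,
    Nat.card {p : x.1.Partition // IsTCore t p} * Nat.card {p : x.2.Partition // IsTCore t p} := by
  rw [numA, Nat.card_congr (pairEquiv t n), Nat.card_sigma]
  simp only [Nat.card_prod]
  exact Finset.sum_coe_sort (Finset.HasAntidiagonal.antidiagonal n) (fun x =>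
    Nat.card {p : x.1.Partition // IsTCore t p} * Nat.card {p : x.2.Partition // IsTCore t p})

theorem stmt_4 : ∀ n : ℕ, 125 ∣ numA 5 2 (125 * n + 123) := by
  intro n
  have hT := eulerSeries_mul_eq_of_coeff
    (T := PowerSeries.mk fun n => (Nat.card {p : n.Partition // IsTCore 5 p} : ℤ))
    (fun n m h => by rw [PowerSeries.coeff_mk, card_isTCore_five h])
  have h := dvd_coeff_sq section5_zero_mul_section5_two hT n
  rw [sq, PowerSeries.coeff_mul] at h
  simp only [PowerSeries.coeff_mk] at h
  rw [numA_two]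
  exact_mod_cast h
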